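/- For n ≥ 2 and real z < 1 define M_n(z) := 1 + Σ_{j=1}^{n-1} (-1)^{j-1} C(n-1, j) · z/(h_j - z), where h_j = Σ_{i=1}^j 1/i. Then for every real t, lim_{n→∞} exp(-t·(6/π²)·√(log n)) · M_n(t/√(log n)) = exp(t²·ζ(3)/ζ(2)³), where ζ(2) = π²/6 and ζ(3) = Σ_{k≥1} k^{-3}. (This says that (D_n − μ log n)/√(log n) converges in distribution to Normal(0, σ²) with μ = 1/ζ(2) = 6/π² and σ² = 2ζ(3)/ζ(2)³.) -/

import Mathlib

open Filter

/-- The `m`-th harmonic number `h_m = ∑_{i=1}^m 1/i`, with `h_0 = 0`. -/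
noncomputable def harm (m : ℕ) : ℝ := ∑ i ∈ Finset.range m, (1 : ℝ) / (i + 1)

/-- `M_n(z) = 1 + Σ_{j=1}^{n-1} (-1)^{j-1} C(n-1,j) · z/(h_j - z)`
(equal to `E[e^{zD_n}]` in the paper). -/
noncomputable def M (n : ℕ) (z : ℝ) : ℝ :=
  1 + ∑ j ∈ Finset.Icc 1 (n - 1),
        (-1 : ℝ) ^ (j - 1) * ((n - 1).choose j) * (z / (harm j - z))

/-- `ζ(3) = Σ_{k≥1} k⁻³`. -/
noncomputable def zeta3 : ℝ := ∑' k : ℕ, (1 : ℝ) / ((k : ℝ) + 1) ^ 3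

lemma harm_succ (m : ℕ) : harm (m+1) = harm m + 1 / ((m:ℝ)+1) := by
  simp [harm, Finset.sum_range_succ]

lemma harm_zero : harm 0 = 0 := by simp [harm]

lemma harm_mono : Monotone harm := by
  refine monotone_nat_of_le_succ fun m => ?_
  rw [harm_succ]
  have : (0:ℝ) ≤ 1 / ((m:ℝ)+1) := by positivity
  linarith

lemma one_le_harm {m : ℕ} (hm : 1 ≤ m) : 1 ≤ harm m := by
  have := harm_mono hm
  rw [harm_succ, harm_zero] at this
  simpa using this

lemma harm_nonneg (m : ℕ) : 0 ≤ harm m := by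
  rw [← harm_zero]; exact harm_mono (Nat.zero_le m)

lemma harm_eq_harmonic (m : ℕ) : harm m = (harmonic m : ℝ) := by
  simp [harm, harmonic]

lemma choose_sum (m : ℕ) : ∀ j : ℕ, ∑ k ∈ Finset.range m, (k.choose j : ℝ) / ((m:ℝ) - k)
    = (harm m - harm j) * (m.choose j) := by
  induction m with
  | zero =>
    intro j
    cases j <;> simp
  | succ m ih =>
    intro j
    rw [Finset.sum_range_succ']
    cases j with
    | zero =>
      have := ih 0
      simp only [Nat.choose_zero_right, harm_zero, Nat.cast_one, mul_one, sub_zero] at this ⊢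
      rw [harm_succ, ← this]
      push_cast
      simp
    | succ j =>
      have h1 := ih j
      have h2 := ih (j+1)
      have h3 : ∑ k ∈ Finset.range m, ((k+1).choose (j+1) : ℝ) / (((m+1 : ℕ):ℝ) - ((k+1 : ℕ) : ℝ))
          = ∑ k ∈ Finset.range m, (k.choose j : ℝ) / ((m:ℝ) - k)
            + ∑ k ∈ Finset.range m, (k.choose (j+1) : ℝ) / ((m:ℝ) - k) := by
        rw [← Finset.sum_add_distrib]
        refine Finset.sum_congr rfl fun k _ => ?_
        rw [Nat.choose_succ_succ]
        push_cast
        rw [← add_div]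
        congr 1
        ring
      rw [h3, h1, h2]
      have h4 : ((m:ℝ)+1) * (m.choose j) = ((m+1).choose (j+1)) * ((j:ℝ)+1) := by
        exact_mod_cast Nat.add_one_mul_choose_eq m j
      have h5 : ((m+1).choose (j+1) : ℝ) = m.choose j + m.choose (j+1) := by
        rw [Nat.choose_succ_succ]; push_cast; ring
      have h6 : (m.choose j : ℝ) / ((j:ℝ)+1) = ((m+1).choose (j+1)) / ((m:ℝ)+1) := by
        rw [div_eq_div_iff (by positivity) (by positivity)]; linarith
      have h7 : ((0:ℕ).choose (j+1) : ℝ) = 0 := by simp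
      rw [h7, harm_succ m, harm_succ j, zero_div, add_zero]
      have e1 : (harm m + 1 / ((m:ℝ)+1) - (harm j + 1 / ((j:ℝ)+1))) * ((m+1).choose (j+1))
        = (harm m - (harm j + 1 / ((j:ℝ)+1))) * ((m+1).choose (j+1))
          + ((m+1).choose (j+1)) / ((m:ℝ)+1) := by ring
      rw [e1, ← h6, h5]
      ring

lemma M_eq (k m : ℕ) (h : k ≤ m) (z : ℝ) : M (k+1) z = 1 + ∑ j ∈ Finset.Icc 1 m,
    ((-1 : ℝ) ^ (j - 1) * (z / (harm j - z))) * (k.choose j) := by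
  unfold M
  simp only [Nat.add_sub_cancel]
  congr 1
  have : Finset.Icc 1 k ⊆ Finset.Icc 1 m := Finset.Icc_subset_Icc_right h
  rw [← Finset.sum_subset this]
  · refine Finset.sum_congr rfl fun j _ => by ring
  · intro j hj hj'
    simp only [Finset.mem_Icc, not_and, not_le] at hj hj'
    rw [Nat.choose_eq_zero_of_lt (hj' hj.1)]; simp

lemma alt_sum (m : ℕ) (hm : 1 ≤ m) :
    ∑ j ∈ Finset.Icc 1 m, (-1 : ℝ) ^ (j - 1) * (m.choose j) = 1 := by
  have h := Int.alternating_sum_range_choose_of_ne (n := m) (by omega)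
  have h' : ∑ j ∈ Finset.range (m+1), (-1 : ℝ) ^ j * (m.choose j) = 0 := by exact_mod_cast h
  rw [Finset.sum_range_succ'] at h'
  rw [Finset.range_eq_Ico, Finset.sum_Ico_add' (fun j => (-1 : ℝ) ^ j * (m.choose j)) 0 m 1] at h'
  have e : Finset.Ico (0+1) (m+1) = Finset.Icc 1 m := by ext; simp
  rw [e] at h'
  have : ∑ j ∈ Finset.Icc 1 m, (-1 : ℝ) ^ j * (m.choose j)
     = - ∑ j ∈ Finset.Icc 1 m, (-1 : ℝ) ^ (j - 1) * (m.choose j) := by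
    rw [← Finset.sum_neg_distrib]
    refine Finset.sum_congr rfl fun j hj => ?_
    obtain ⟨i, rfl⟩ : ∃ i, j = i + 1 := ⟨j-1, by simp at hj; omega⟩
    simp [pow_succ]
  rw [this] at h'
  simp at h'
  linarith

lemma M_rec (z : ℝ) (hz : z < 1) (m : ℕ) (hm : 1 ≤ m) :
    (harm m - z) * M (m+1) z = ∑ k ∈ Finset.range m, M (k+1) z / ((m:ℝ) - k) := by
  have h1 : ∑ k ∈ Finset.range m, M (k+1) z / ((m:ℝ) - k)
      = ∑ k ∈ Finset.range m, (1 / ((m:ℝ) - k) + ∑ j ∈ Finset.Icc 1 m,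
        ((-1 : ℝ) ^ (j - 1) * (z / (harm j - z))) * ((k.choose j : ℝ) / ((m:ℝ) - k))) := by
    refine Finset.sum_congr rfl fun k hk => ?_
    rw [M_eq k m (Finset.mem_range.1 hk).le, add_div, Finset.sum_div]
    congr 1
    refine Finset.sum_congr rfl fun j _ => by ring
  have h0 := choose_sum m 0
  simp only [Nat.choose_zero_right, harm_zero, Nat.cast_one, mul_one, sub_zero] at h0
  rw [h1, Finset.sum_add_distrib, h0, Finset.sum_comm]
  simp_rw [← Finset.mul_sum, choose_sum]
  rw [M_eq m m le_rfl, mul_add, Finset.mul_sum, ← sub_eq_zero]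
  have h2 : ∑ j ∈ Finset.Icc 1 m, (harm m - z) * (((-1 : ℝ) ^ (j - 1) * (z / (harm j - z))) * (m.choose j))
    - ∑ j ∈ Finset.Icc 1 m, ((-1 : ℝ) ^ (j - 1) * (z / (harm j - z))) * ((harm m - harm j) * (m.choose j))
    = z * ∑ j ∈ Finset.Icc 1 m, (-1 : ℝ) ^ (j - 1) * (m.choose j) := by
    rw [← Finset.sum_sub_distrib, Finset.mul_sum]
    refine Finset.sum_congr rfl fun j hj => ?_
    have : harm j - z ≠ 0 := by
      have := one_le_harm (Finset.mem_Icc.1 hj).1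
      linarith
    field_simp
    ring
  rw [alt_sum m hm] at h2
  linarith

lemma M_one (z : ℝ) : M 1 z = 1 := by simp [M]

lemma comp_upper (z : ℝ) (hz : z < 1) (f : ℕ → ℝ) (K : ℝ) (hK : 0 ≤ K) (N : ℕ)
    (h0 : ∀ m ≤ N, M (m+1) z ≤ K * f m)
    (h1 : ∀ m, N < m → ∑ k ∈ Finset.range m, f k / ((m:ℝ) - k) ≤ (harm m - z) * f m) (m : ℕ) :
    M (m+1) z ≤ K * f m := by
  induction m using Nat.strong_induction_on with
  | _ m ih =>
    rcases le_or_gt m N with h | h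
    · exact h0 m h
    have hp : 0 < harm m - z := by
      have := one_le_harm (show 1 ≤ m by omega)
      linarith
    refine le_of_mul_le_mul_left ?_ hp
    rw [M_rec z hz m (by omega)]
    calc _ ≤ ∑ k ∈ Finset.range m, K * (f k / ((m:ℝ) - k)) := by
          refine Finset.sum_le_sum fun k hk => ?_
          have hk' := Finset.mem_range.1 hk
          have : (0:ℝ) < (m:ℝ) - k := by
            have : (k:ℝ) < m := by exact_mod_cast hk'
            linarith
          rw [← mul_div_assoc]
          exact div_le_div_of_nonneg_right (ih k hk') this.le
      _ = K * ∑ k ∈ Finset.range m, (f k / ((m:ℝ) - k)) := by rw [Finset.mul_sum]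
      _ ≤ K * ((harm m - z) * f m) := mul_le_mul_of_nonneg_left (h1 m h) hK
      _ = _ := by ring

lemma comp_lower (z : ℝ) (hz : z < 1) (f : ℕ → ℝ) (K : ℝ) (hK : 0 ≤ K) (N : ℕ)
    (h0 : ∀ m ≤ N, K * f m ≤ M (m+1) z)
    (h1 : ∀ m, N < m → (harm m - z) * f m ≤ ∑ k ∈ Finset.range m, f k / ((m:ℝ) - k)) (m : ℕ) :
    K * f m ≤ M (m+1) z := by
  induction m using Nat.strong_induction_on with
  | _ m ih =>
    rcases le_or_gt m N with h | h
    · exact h0 m h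
    have hp : 0 < harm m - z := by
      have := one_le_harm (show 1 ≤ m by omega)
      linarith
    refine le_of_mul_le_mul_left ?_ hp
    rw [M_rec z hz m (by omega)]
    calc _ = K * ((harm m - z) * f m) := by ring
      _ ≤ K * ∑ k ∈ Finset.range m, (f k / ((m:ℝ) - k)) := mul_le_mul_of_nonneg_left (h1 m h) hK
      _ = ∑ k ∈ Finset.range m, K * (f k / ((m:ℝ) - k)) := by rw [Finset.mul_sum]
      _ ≤ _ := by
          refine Finset.sum_le_sum fun k hk => ?_
          have hk' := Finset.mem_range.1 hk
          have : (0:ℝ) < (m:ℝ) - k := by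
            have : (k:ℝ) < m := by exact_mod_cast hk'
            linarith
          rw [← mul_div_assoc]
          exact div_le_div_of_nonneg_right (ih k hk') this.le

/-- The comparison function `∏_{i ≤ m} (1 + s/i)`. -/
noncomputable def FF (s : ℝ) (m : ℕ) : ℝ := ∏ i ∈ Finset.range m, (1 + s / ((i:ℝ)+1))

/-- The partial sums `∑_{i ≤ m} s/(i(i+s))`. -/
noncomputable def HH (s : ℝ) (m : ℕ) : ℝ :=
  ∑ i ∈ Finset.range m, s / (((i:ℝ)+1) * ((i:ℝ)+1+s))

lemma FF_succ (s : ℝ) (m : ℕ) : FF s (m+1) = FF s m * (1 + s / ((m:ℝ)+1)) := by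
  simp [FF, Finset.prod_range_succ]

lemma HH_succ (s : ℝ) (m : ℕ) : HH s (m+1) = HH s m + s / (((m:ℝ)+1) * ((m:ℝ)+1+s)) := by
  simp [HH, Finset.sum_range_succ]

lemma FF_rec (s : ℝ) (m : ℕ) : ∑ k ∈ Finset.range (m+1), FF s k / (((m+1:ℕ):ℝ) - k)
    = (((m:ℝ)+1+s) * (∑ k ∈ Finset.range m, FF s k / ((m:ℝ) - k)) + FF s m) / ((m:ℝ)+1) := by
  have hm : (m:ℝ)+1 ≠ 0 := by positivity
  rw [eq_div_iff hm]
  have h1 : (∑ k ∈ Finset.range (m+1), FF s k / (((m+1:ℕ):ℝ) - k)) * ((m:ℝ)+1)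
      = ∑ k ∈ Finset.range (m+1), (FF s k + (k:ℝ) * FF s k / (((m+1:ℕ):ℝ) - k)) := by
    rw [Finset.sum_mul]
    refine Finset.sum_congr rfl fun k hk => ?_
    have hk' := Finset.mem_range.1 hk
    have : (k:ℝ) < ((m+1:ℕ):ℝ) := by exact_mod_cast hk'
    have h : ((m+1:ℕ):ℝ) - k ≠ 0 := by linarith
    push_cast at h ⊢
    field_simp
    ring
  have h2 : ∑ k ∈ Finset.range (m+1), ((k:ℝ) * FF s k / (((m+1:ℕ):ℝ) - k))
      = ∑ k ∈ Finset.range m, (((m:ℝ)+1+s) * (FF s k / ((m:ℝ) - k)) - FF s k) := by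
    rw [Finset.sum_range_succ']
    simp only [Nat.cast_zero, zero_mul, zero_div, add_zero]
    refine Finset.sum_congr rfl fun k hk => ?_
    have hk' := Finset.mem_range.1 hk
    have : (k:ℝ) < (m:ℝ) := by exact_mod_cast hk'
    have h : (m:ℝ) - k ≠ 0 := by linarith
    have h' : (k:ℝ)+1 ≠ 0 := by positivity
    rw [FF_succ]
    push_cast
    rw [show (m:ℝ)+1-(k+1) = m - k by ring]
    field_simp
    ring
  rw [h1, Finset.sum_add_distrib, h2, Finset.sum_sub_distrib, ← Finset.mul_sum,
    Finset.sum_range_succ]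
  ring

lemma FF_sum (s : ℝ) (hs : -1 < s) (m : ℕ) : ∑ k ∈ Finset.range m, FF s k / ((m:ℝ) - k)
    = FF s m * (harm m - HH s m) := by
  induction m with
  | zero => simp [harm, HH]
  | succ m ih =>
    rw [FF_rec, ih, FF_succ, HH_succ, harm_succ]
    have h' : (m:ℝ)+1 ≠ 0 := by positivity
    have h2 : (m:ℝ)+1+s ≠ 0 := by
      have : (0:ℝ) ≤ m := by positivity
      linarith
    field_simp
    ring

lemma FF_pos (s : ℝ) (hs : -1 < s) (m : ℕ) : 0 < FF s m := by
  refine Finset.prod_pos fun i _ => ?_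
  have h : (0:ℝ) < (i:ℝ)+1 := by positivity
  have : (0:ℝ) ≤ i := by positivity
  rw [show 1 + s / ((i:ℝ)+1) = ((i:ℝ)+1+s)/((i:ℝ)+1) by field_simp]
  apply div_pos _ h
  linarith

lemma M_upper (z : ℝ) (hz : z < 1) (s : ℝ) (hs : -1 < s) (K : ℝ) (hK : 0 ≤ K) (N : ℕ)
    (h0 : ∀ m ≤ N, M (m+1) z ≤ K * FF s m)
    (h1 : ∀ m, N < m → z ≤ HH s m) (m : ℕ) : M (m+1) z ≤ K * FF s m := by
  refine comp_upper z hz _ K hK N h0 (fun m hm => ?_) m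
  rw [FF_sum s hs, mul_comm]
  exact mul_le_mul_of_nonneg_right (by linarith [h1 m hm]) (FF_pos s hs m).le

lemma M_lower (z : ℝ) (hz : z < 1) (s : ℝ) (hs : -1 < s) (K : ℝ) (hK : 0 ≤ K) (N : ℕ)
    (h0 : ∀ m ≤ N, K * FF s m ≤ M (m+1) z)
    (h1 : ∀ m, N < m → HH s m ≤ z) (m : ℕ) : K * FF s m ≤ M (m+1) z := by
  refine comp_lower z hz _ K hK N h0 (fun m hm => ?_) m
  rw [FF_sum s hs, mul_comm (FF s m)]
  exact mul_le_mul_of_nonneg_right (by linarith [h1 m hm]) (FF_pos s hs m).le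

lemma HH_ge (s : ℝ) (hs : 0 ≤ s) (m : ℕ) (hm : 1 ≤ m) : s / (1+s) ≤ HH s m := by
  obtain ⟨m, rfl⟩ : ∃ k, m = k + 1 := ⟨m-1, by omega⟩
  rw [HH, Finset.sum_range_succ']
  have : 0 ≤ ∑ k ∈ Finset.range m, s / ((((k+1:ℕ):ℝ)+1) * (((k+1:ℕ):ℝ)+1+s)) :=
    Finset.sum_nonneg fun i _ => by positivity
  simp at this ⊢
  linarith

lemma HH_le (s : ℝ) (hs : 0 ≤ s) (hs1 : s < 1) (m : ℕ) (hm : 1 ≤ m) : HH (-s) m ≤ -s := by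
  obtain ⟨m, rfl⟩ : ∃ k, m = k + 1 := ⟨m-1, by omega⟩
  rw [HH, Finset.sum_range_succ']
  have : ∑ k ∈ Finset.range m, (-s) / ((((k+1:ℕ):ℝ)+1) * (((k+1:ℕ):ℝ)+1+(-s))) ≤ 0 := by
    refine Finset.sum_nonpos fun i _ => ?_
    have : (0:ℝ) ≤ ((i+1:ℕ):ℝ) := by positivity
    apply div_nonpos_of_nonpos_of_nonneg (by linarith)
    apply mul_nonneg <;> linarith
  have h2 : (-s) / ((((0:ℕ):ℝ)+1) * (((0:ℕ):ℝ)+1+(-s))) ≤ -s := by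
    rw [div_le_iff₀ (by simp; linarith)]
    simp
    nlinarith
  linarith

lemma apriori (z : ℝ) (hz : |z| ≤ 1/4) (m : ℕ) :
    FF (-(2*|z|)) m ≤ M (m+1) z ∧ M (m+1) z ≤ FF (2*|z|) m := by
  have h0 := abs_nonneg z
  have hz1 : z < 1 := by linarith [le_abs_self z]
  constructor
  · rw [← one_mul (FF _ m)]
    refine M_lower z hz1 _ (by linarith) 1 zero_le_one 0 (fun m hm => ?_) (fun m hm => ?_) m
    · obtain rfl : m = 0 := by omega
      simp [FF, M_one]
    · have := HH_le (2*|z|) (by linarith) (by linarith) m hm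
      linarith [neg_abs_le z]
  · rw [← one_mul (FF _ m)]
    refine M_upper z hz1 _ (by linarith) 1 zero_le_one 0 (fun m hm => ?_) (fun m hm => ?_) m
    · obtain rfl : m = 0 := by omega
      simp [FF, M_one]
    · have := HH_ge (2*|z|) (by linarith) m hm
      refine le_trans ?_ this
      rw [le_div_iff₀ (by linarith)]
      nlinarith [le_abs_self z]

lemma FF_le_exp (s : ℝ) (hs : -1 < s) (m : ℕ) : FF s m ≤ Real.exp (s * harm m) := by
  rw [harm, Finset.mul_sum, Real.exp_sum]
  refine Finset.prod_le_prod (fun i _ => ?_) (fun i _ => ?_)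
  · have : (0:ℝ) ≤ i := by positivity
    rw [show 1 + s / ((i:ℝ)+1) = ((i:ℝ)+1+s)/((i:ℝ)+1) by field_simp]
    apply div_nonneg <;> linarith
  · rw [mul_one_div]
    linarith [Real.add_one_le_exp (s / ((i:ℝ)+1))]

lemma tail_bound (a : ℕ → ℝ) (Z : ℝ) (hZ : HasSum a Z) (h0 : ∀ i, 0 ≤ a i)
    (h1 : ∀ i, a i ≤ 1 / ((i:ℝ)+1)^2) (m : ℕ) (hm : 1 ≤ m) :
    |∑ i ∈ Finset.range m, a i - Z| ≤ 1 / (m:ℝ) := by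
  have hle : ∑ i ∈ Finset.range m, a i ≤ Z := sum_le_hasSum _ (fun i _ => h0 i) hZ
  have hk : ∀ k : ℕ, ∑ i ∈ Finset.range (m+k), a i + 1 / ((m+k:ℕ):ℝ)
      ≤ ∑ i ∈ Finset.range m, a i + 1 / (m:ℝ) := by
    intro k
    induction k with
    | zero => simp
    | succ k ih =>
      refine le_trans ?_ ih
      rw [← add_assoc, Finset.sum_range_succ]
      have h := h1 (m+k)
      have hp : (1:ℝ) ≤ ((m+k:ℕ):ℝ) := by exact_mod_cast (by omega : 1 ≤ m+k)
      set y := ((m+k:ℕ):ℝ) with hy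
      have e : ((m+k+1:ℕ):ℝ) = y + 1 := by rw [hy]; push_cast; ring
      rw [e]
      have : 1 / (y+1)^2 + 1/(y+1) ≤ 1 / y := by
        rw [div_add_div _ _ (by positivity) (by positivity), div_le_div_iff₀ (by positivity) (by positivity)]
        nlinarith
      linarith
  have hge : Z ≤ ∑ i ∈ Finset.range m, a i + 1 / (m:ℝ) := by
    have ht := (tendsto_add_atTop_iff_nat m).2 hZ.tendsto_sum_nat
    refine le_of_tendsto' ht fun k => ?_
    have := hk k
    rw [add_comm k m]
    have h : (0:ℝ) ≤ 1 / ((m+k:ℕ):ℝ) := by positivity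
    linarith
  rw [abs_le]
  have h : (0:ℝ) ≤ 1 / (m:ℝ) := by positivity
  constructor <;> linarith

lemma hasSum_two : HasSum (fun i : ℕ => 1 / ((i:ℝ)+1)^2) (Real.pi^2/6) := by
  have := (hasSum_nat_add_iff' 1).2 hasSum_zeta_two
  simpa using this

lemma summable_three : Summable (fun i : ℕ => 1 / ((i:ℝ)+1)^3) := by
  refine Summable.of_nonneg_of_le (fun i => by positivity) (fun i => ?_) hasSum_two.summable
  refine one_div_le_one_div_of_le (by positivity) (pow_le_pow_right₀ ?_ (by norm_num))
  have : (0:ℝ) ≤ i := by positivity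
  linarith

lemma hasSum_three : HasSum (fun i : ℕ => 1 / ((i:ℝ)+1)^3) zeta3 := summable_three.hasSum

lemma sum_sq_le (m : ℕ) : ∑ i ∈ Finset.range m, 1 / ((i:ℝ)+1)^2 ≤ 2 := by
  have h := sum_le_hasSum (Finset.range m) (fun i _ => by positivity) hasSum_two
  refine h.trans ?_
  have h1 := Real.pi_lt_d2
  have h2 := Real.pi_pos
  nlinarith

lemma exp_sub_sq_le (y : ℝ) (hy : |y| ≤ 1/2) : Real.exp (y - 2*y^2) ≤ 1 + y := by
  have h := abs_le.1 hy
  have h1 : (0:ℝ) < 1 - (y - 2*y^2) := by nlinarith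
  have h2 : 1 - (y - 2*y^2) ≤ Real.exp (-(y - 2*y^2)) := Real.one_sub_le_exp_neg _
  rw [Real.exp_neg, le_inv_comm₀ h1 (Real.exp_pos _)] at h2
  refine h2.trans ?_
  rw [inv_le_iff_one_le_mul₀ h1]
  nlinarith [mul_nonneg (sq_nonneg y) (show 0 ≤ 1+2*y by linarith)]

lemma FF_ge_exp (s : ℝ) (hs : |s| ≤ 1/2) (m : ℕ) :
    Real.exp (s * harm m - 4 * s^2) ≤ FF s m := by
  have h1 : Real.exp (s * harm m - 4 * s^2) ≤
     Real.exp (∑ i ∈ Finset.range m, (s / ((i:ℝ)+1) - 2*(s / ((i:ℝ)+1))^2)) := by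
    rw [Real.exp_le_exp, Finset.sum_sub_distrib, harm, Finset.mul_sum]
    have e : ∑ i ∈ Finset.range m, (s / ((i:ℝ)+1))^2 ≤ 2 * s^2 := by
      have := sum_sq_le m
      calc _ = s^2 * ∑ i ∈ Finset.range m, 1 / ((i:ℝ)+1)^2 := by
            rw [Finset.mul_sum]
            refine Finset.sum_congr rfl fun i _ => by rw [div_pow]; ring
        _ ≤ s^2 * 2 := mul_le_mul_of_nonneg_left this (sq_nonneg s)
        _ = _ := by ring
    simp_rw [mul_one_div]
    rw [← Finset.mul_sum]
    linarith
  refine h1.trans ?_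
  rw [Real.exp_sum]
  refine Finset.prod_le_prod (fun i _ => (Real.exp_pos _).le) (fun i _ => ?_)
  apply exp_sub_sq_le
  rw [abs_div]
  refine le_trans (div_le_self (abs_nonneg s) ?_) hs
  rw [abs_of_nonneg (by positivity)]
  have : (0:ℝ) ≤ i := by positivity
  linarith

lemma HH_est (s : ℝ) (hs : |s| ≤ 1/2) (m : ℕ) (hm : 1 ≤ m) :
    |HH s m - (Real.pi^2/6 * s - zeta3 * s^2)| ≤ 4 * |s|^3 + 2 * |s| / m := by
  have hs' := abs_le.1 hs
  have e : HH s m = s * ∑ i ∈ Finset.range m, 1 / ((i:ℝ)+1)^2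
      - s^2 * ∑ i ∈ Finset.range m, 1 / ((i:ℝ)+1)^3
      + ∑ i ∈ Finset.range m, s^3 / (((i:ℝ)+1)^3 * ((i:ℝ)+1+s)) := by
    rw [HH, Finset.mul_sum, Finset.mul_sum, ← Finset.sum_sub_distrib, ← Finset.sum_add_distrib]
    refine Finset.sum_congr rfl fun i _ => ?_
    have h0 : (0:ℝ) ≤ i := by positivity
    have h1 : (i:ℝ)+1 ≠ 0 := by positivity
    have h2 : (i:ℝ)+1+s ≠ 0 := by linarith
    field_simp
    ring
  have hr : |∑ i ∈ Finset.range m, s^3 / (((i:ℝ)+1)^3 * ((i:ℝ)+1+s))| ≤ 4 * |s|^3 := by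
    refine (Finset.abs_sum_le_sum_abs _ _).trans ?_
    calc _ ≤ ∑ i ∈ Finset.range m, (2 * |s|^3) * (1 / ((i:ℝ)+1)^2) := by
          refine Finset.sum_le_sum fun i _ => ?_
          have h0 : (0:ℝ) ≤ i := by positivity
          have h2 : (0:ℝ) < (i:ℝ)+1+s := by linarith
          rw [abs_div, abs_pow, abs_of_pos (show 0 < ((i:ℝ)+1)^3 * ((i:ℝ)+1+s) by positivity),
            mul_one_div, div_le_div_iff₀ (by positivity) (by positivity)]
          have : ((i:ℝ)+1)^2 ≤ 2 * (((i:ℝ)+1)^3 * ((i:ℝ)+1+s)) := by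
            have h3 : 1 ≤ 2 * (((i:ℝ)+1) * ((i:ℝ)+1+s)) := by nlinarith
            nlinarith [mul_le_mul_of_nonneg_left h3 (sq_nonneg ((i:ℝ)+1))]
          nlinarith [mul_le_mul_of_nonneg_left this (pow_nonneg (abs_nonneg s) 3)]
      _ = (2 * |s|^3) * ∑ i ∈ Finset.range m, 1 / ((i:ℝ)+1)^2 := by rw [Finset.mul_sum]
      _ ≤ (2 * |s|^3) * 2 := mul_le_mul_of_nonneg_left (sum_sq_le m) (by positivity)
      _ = _ := by ring
  have b2 := tail_bound _ _ hasSum_two (fun i => by positivity) (fun i => le_rfl) m hm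
  have b3 := tail_bound _ _ hasSum_three (fun i => by positivity) (fun i => by
    refine one_div_le_one_div_of_le (by positivity) (pow_le_pow_right₀ ?_ (by norm_num))
    have : (0:ℝ) ≤ i := by positivity
    linarith) m hm
  set S2 := ∑ i ∈ Finset.range m, 1 / ((i:ℝ)+1)^2
  set S3 := ∑ i ∈ Finset.range m, 1 / ((i:ℝ)+1)^3
  set R := ∑ i ∈ Finset.range m, s^3 / (((i:ℝ)+1)^3 * ((i:ℝ)+1+s))
  have e2 : HH s m - (Real.pi^2/6 * s - zeta3 * s^2)
      = s * (S2 - Real.pi^2/6) - s^2 * (S3 - zeta3) + R := by rw [e]; ring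
  have c2 : |s * (S2 - Real.pi^2/6)| ≤ |s| * (1/m) := by
    rw [abs_mul]; exact mul_le_mul_of_nonneg_left b2 (abs_nonneg s)
  have c3 : |s^2 * (S3 - zeta3)| ≤ |s| * (1/m) := by
    rw [abs_mul]
    refine mul_le_mul ?_ b3 (abs_nonneg _) (abs_nonneg s)
    rw [abs_pow, sq]
    nlinarith [abs_nonneg s]
  rw [e2]
  have t1 := abs_add_le (s * (S2 - Real.pi^2/6) - s^2 * (S3 - zeta3)) R
  have t2 := abs_sub (s * (S2 - Real.pi^2/6)) (s^2 * (S3 - zeta3))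
  have : 2 * |s| / m = |s| * (1/m) + |s| * (1/m) := by ring
  linarith

/-- Error function. -/
noncomputable def EE (A b x : ℝ) : ℝ :=
  |zeta3| * |2 * A * b * x + b^2 * x^2| + 4 * |A + b*x|^3 * x + 2 * |A + b*x| * x

lemma EE_tendsto (A b : ℝ) : Tendsto (EE A b) (nhds 0) (nhds 0) := by
  have : Continuous (EE A b) := by unfold EE; fun_prop
  have h := this.tendsto 0
  simpa [EE] using h

lemma HH_err (t b x : ℝ) (hx : 0 < x) (m : ℕ) (hm : 1 ≤ m) (hxm : 1 / x^2 ≤ m)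
    (hs : |(t / (Real.pi^2/6) + b * x) * x| ≤ 1/2) :
    |HH ((t / (Real.pi^2/6) + b * x) * x) m - t * x
      - Real.pi^2/6 * (b - t^2 * zeta3 / (Real.pi^2/6)^3) * x^2|
      ≤ x^2 * EE (t / (Real.pi^2/6)) b x := by
  have h := HH_est _ hs m hm
  have hZ : Real.pi^2/6 ≠ 0 := by positivity
  set Z := Real.pi^2/6
  set A := t / Z with hA
  have ht : t = A * Z := by rw [hA]; field_simp
  have hc : t^2 * zeta3 / Z^3 = A^2 * zeta3 / Z := by rw [ht]; field_simp
  rw [hc]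
  have e : HH ((A + b * x) * x) m - t * x - Z * (b - A^2 * zeta3 / Z) * x^2
     = (HH ((A + b * x) * x) m - (Z * ((A + b * x) * x) - zeta3 * ((A + b * x) * x)^2))
       + - (zeta3 * (2 * A * b * x + b^2 * x^2) * x^2) := by
    rw [ht]; field_simp; ring
  rw [e]
  refine (abs_add_le _ _).trans ?_
  rw [abs_neg, abs_mul _ (x^2), abs_mul zeta3, abs_of_pos (show 0 < x^2 by positivity)]
  have hm0 : (0:ℝ) < m := by exact_mod_cast hm
  have h1m : 1 / (m:ℝ) ≤ x^2 := by
    rw [div_le_iff₀ (by positivity)] at hxm ⊢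
    linarith
  have h2 : 2 * |(A + b * x) * x| / m ≤ 2 * |(A + b * x) * x| * x^2 := by
    rw [div_eq_mul_one_div]
    exact mul_le_mul_of_nonneg_left h1m (by positivity)
  rw [abs_mul (A+b*x), abs_of_pos hx] at h h2
  unfold EE
  nlinarith

lemma tend_x : Tendsto (fun n : ℕ => (Real.sqrt (Real.log n))⁻¹) atTop (nhds 0) := by
  refine tendsto_inv_atTop_zero.comp ?_
  exact Real.tendsto_sqrt_atTop.comp (Real.tendsto_log_atTop.comp tendsto_natCast_atTop_atTop)

lemma harm_le (N : ℕ) : harm N ≤ 1 + Real.log N := by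
  rw [harm_eq_harmonic]; exact harmonic_le_one_add_log N

lemma tend_harm : Tendsto (fun n : ℕ => (Real.sqrt (Real.log n))⁻¹ * harm ⌈Real.log n⌉₊)
    atTop (nhds 0) := by
  have hu : Tendsto (fun n : ℕ => Real.sqrt (Real.log n)) atTop atTop :=
    Real.tendsto_sqrt_atTop.comp (Real.tendsto_log_atTop.comp tendsto_natCast_atTop_atTop)
  have h1 : Tendsto (fun u : ℝ => u⁻¹ * (1 + Real.log 2) + 2 * (Real.log u / u)) atTop (nhds 0) := by
    have ha : Tendsto (fun u : ℝ => Real.log u / u) atTop (nhds 0) :=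
      Real.isLittleO_log_id_atTop.tendsto_div_nhds_zero
    have := (tendsto_inv_atTop_zero (𝕜 := ℝ)).mul_const (1 + Real.log 2) |>.add (ha.const_mul 2)
    simpa using this
  refine squeeze_zero' (Eventually.of_forall fun n => ?_) ?_ (h1.comp hu)
  · exact mul_nonneg (by positivity) (harm_nonneg _)
  · filter_upwards [hu.eventually_ge_atTop 1] with n hn
    simp only [Function.comp]
    set u := Real.sqrt (Real.log n) with hudef
    have hL : Real.log n = u^2 := by
      rw [hudef, Real.sq_sqrt (Real.log_natCast_nonneg n)]
    rw [hL]
    have hN : ((⌈u^2⌉₊ : ℕ) : ℝ) ≤ 2 * u^2 := by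
      have := (Nat.ceil_lt_add_one (show 0 ≤ u^2 by positivity)).le
      nlinarith
    have hN0 : (0:ℝ) < (⌈u^2⌉₊ : ℕ) := by
      have : 0 < u^2 := by positivity
      exact_mod_cast Nat.ceil_pos.2 this
    have h2 := harm_le ⌈u^2⌉₊
    have h3 : Real.log (⌈u^2⌉₊ : ℕ) ≤ Real.log 2 + 2 * Real.log u := by
      refine (Real.log_le_log hN0 hN).trans ?_
      rw [Real.log_mul (by norm_num) (by positivity), Real.log_pow]
      norm_num
    calc u⁻¹ * harm ⌈u^2⌉₊ ≤ u⁻¹ * (1 + (Real.log 2 + 2 * Real.log u)) :=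
          mul_le_mul_of_nonneg_left (by linarith) (by positivity)
      _ = _ := by ring

lemma harm_log (m : ℕ) : |harm m - Real.log ((m+1:ℕ):ℝ)| ≤ 1 := by
  have h1 := log_add_one_le_harmonic m
  have h2 := harm_le m
  rw [← harm_eq_harmonic] at h1
  have h3 : Real.log m ≤ Real.log ((m+1:ℕ):ℝ) := by
    rcases Nat.eq_zero_or_pos m with rfl | h
    · simp
    · exact Real.log_le_log (by exact_mod_cast h) (by push_cast; linarith)
  rw [abs_le]
  push_cast at *
  constructor <;> linarith

set_option maxHeartbeats 1000000 in
/-- Exponent common to both bounds. -/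
lemma main_bound (t b x y : ℝ) (hx : 0 < x) (m : ℕ)
    (hL : Real.log ((m+1:ℕ):ℝ) = 1 / x^2) (hz : |t * x| ≤ 1/4)
    (hs : |(t / (Real.pi^2/6) + b * x) * x| ≤ 1/2)
    (hy : y = 2 * |t| * (x * harm ⌈1/x^2⌉₊)
      + |t / (Real.pi^2/6) + b * x| * (x * harm ⌈1/x^2⌉₊)
      + 16 * (t*x)^2 + 4 * ((t / (Real.pi^2/6) + b * x) * x)^2
      + |(t / (Real.pi^2/6) + b * x) * x|) :
    (EE (t / (Real.pi^2/6)) b x < Real.pi^2/6 * (b - t^2 * zeta3 / (Real.pi^2/6)^3) →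
      Real.exp (-(t / (Real.pi^2/6) / x)) * M (m+1) (t * x) ≤ Real.exp (b + y)) ∧
    (EE (t / (Real.pi^2/6)) b x < - (Real.pi^2/6 * (b - t^2 * zeta3 / (Real.pi^2/6)^3)) →
      Real.exp (b - y) ≤ Real.exp (-(t / (Real.pi^2/6) / x)) * M (m+1) (t * x)) := by
  have herr := fun k hk hxk => HH_err t b x hx k hk hxk hs
  set A := t / (Real.pi^2/6) with hA
  set s := (A + b * x) * x with hsdef
  set N := ⌈1/x^2⌉₊ with hN
  have hs2 := abs_le.1 hs
  have hz1 : t * x < 1 := by linarith [le_abs_self (t*x)]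
  have hl := harm_log m
  rw [hL] at hl
  have hsL : s * (1/x^2) = A / x + b := by rw [hsdef]; field_simp
  have hsl : |s * harm m - (A/x + b)| ≤ |s| := by
    rw [← hsL, ← mul_sub, abs_mul]
    nlinarith [abs_nonneg s]
  have hsl' := abs_le.1 hsl
  have hx2 : 0 < x^2 := by positivity
  have hkN : ∀ k, N < k → 1 ≤ k ∧ 1/x^2 ≤ (k:ℝ) := by
    intro k hk
    refine ⟨by omega, ?_⟩
    refine (Nat.le_ceil (1/x^2)).trans ?_
    exact_mod_cast hk.le
  have hsN : |s| * harm N = |A + b*x| * (x * harm N) := by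
    rw [hsdef, abs_mul, abs_of_pos hx]; ring
  have hzN : |t*x| * harm N = |t| * (x * harm N) := by
    rw [abs_mul, abs_of_pos hx]; ring
  have habs : ∀ k ≤ N, |s| * harm k ≤ |s| * harm N ∧ |t*x| * harm k ≤ |t*x| * harm N := fun k hk =>
    ⟨mul_le_mul_of_nonneg_left (harm_mono hk) (abs_nonneg s),
      mul_le_mul_of_nonneg_left (harm_mono hk) (abs_nonneg _)⟩
  have hsk : ∀ k, |s * harm k| = |s| * harm k := fun k => by
    rw [abs_mul, abs_of_nonneg (harm_nonneg k)]
  have ht0 : 0 ≤ |t*x| := abs_nonneg _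
  constructor
  · intro hE
    set K := Real.exp (2 * (|t*x| * harm N) + |s| * harm N + 4 * s^2) with hK
    have hM := M_upper (t*x) hz1 s (by linarith) K (Real.exp_pos _).le N (fun k hk => by
        refine (apriori (t*x) hz k).2.trans ?_
        refine (FF_le_exp (2*|t*x|) (by linarith) k).trans ?_
        refine le_trans ?_ (mul_le_mul_of_nonneg_left (FF_ge_exp s hs k) (Real.exp_pos _).le)
        rw [hK, ← Real.exp_add, Real.exp_le_exp]
        have h1 := habs k hk
        have h2 := neg_abs_le (s * harm k)
        rw [hsk] at h2
        nlinarith) (fun k hk => by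
        obtain ⟨h1, h2⟩ := hkN k hk
        have h3 := (abs_le.1 (herr k h1 h2)).1
        have h4 := mul_lt_mul_of_pos_left hE hx2
        linarith) m
    refine (mul_le_mul_of_nonneg_left (hM.trans (mul_le_mul_of_nonneg_left
      (FF_le_exp s (by linarith) m) (Real.exp_pos _).le)) (Real.exp_pos _).le).trans ?_
    rw [hK, ← Real.exp_add, ← Real.exp_add, Real.exp_le_exp, hy]
    linarith [sq_nonneg (t*x), hsl'.1, hsl'.2, hsN, hzN]
  · intro hE
    set K := Real.exp (-(2 * (|t*x| * harm N) + |s| * harm N + 16 * (t*x)^2)) with hK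
    have hM := M_lower (t*x) hz1 s (by linarith) K (Real.exp_pos _).le N (fun k hk => by
        refine le_trans ?_ (apriori (t*x) hz k).1
        refine le_trans ?_ (FF_ge_exp (-(2*|t*x|)) (by
          rw [abs_neg, abs_of_nonneg (by linarith)]; linarith) k)
        refine (mul_le_mul_of_nonneg_left (FF_le_exp s (by linarith) k) (Real.exp_pos _).le).trans ?_
        rw [← Real.exp_add, Real.exp_le_exp]
        have h1 := habs k hk
        have h2 := le_abs_self (s * harm k)
        rw [hsk] at h2
        have h3 : (-(2*|t*x|))^2 = 4 * (t*x)^2 := by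
          rw [neg_sq, mul_pow, sq_abs]; norm_num
        rw [h3]
        nlinarith) (fun k hk => by
        obtain ⟨h1, h2⟩ := hkN k hk
        have h3 := (abs_le.1 (herr k h1 h2)).2
        have h4 := mul_lt_mul_of_pos_left hE hx2
        linarith) m
    refine le_trans ?_ (mul_le_mul_of_nonneg_left ((mul_le_mul_of_nonneg_left
      (FF_ge_exp s hs m) (Real.exp_pos _).le).trans hM) (Real.exp_pos _).le)
    rw [← Real.exp_add, ← Real.exp_add, Real.exp_le_exp, hy]
    linarith [sq_nonneg (t*x), hsl'.1, hsl'.2, hsN, hzN]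

/-- The vanishing error exponent. -/
noncomputable def YY (t b : ℝ) (n : ℕ) : ℝ :=
  2 * |t| * ((Real.sqrt (Real.log n))⁻¹ * harm ⌈Real.log n⌉₊)
      + |t / (Real.pi^2/6) + b * (Real.sqrt (Real.log n))⁻¹| *
        ((Real.sqrt (Real.log n))⁻¹ * harm ⌈Real.log n⌉₊)
      + 16 * (t*(Real.sqrt (Real.log n))⁻¹)^2
      + 4 * ((t / (Real.pi^2/6) + b * (Real.sqrt (Real.log n))⁻¹) * (Real.sqrt (Real.log n))⁻¹)^2
      + |(t / (Real.pi^2/6) + b * (Real.sqrt (Real.log n))⁻¹) * (Real.sqrt (Real.log n))⁻¹|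

lemma YY_tendsto (t b : ℝ) : Tendsto (YY t b) atTop (nhds 0) := by
  have hx := tend_x
  have hh := tend_harm
  have h1 := hh.const_mul (2*|t|)
  have hA : Tendsto (fun n : ℕ => t / (Real.pi^2/6) + b * (Real.sqrt (Real.log n))⁻¹) atTop
      (nhds (t / (Real.pi^2/6) + b * 0)) := (hx.const_mul b).const_add _
  have h2 := hA.abs.mul hh
  have h3 := ((hx.const_mul t).pow 2).const_mul 16
  have h4 := ((hA.mul hx).pow 2).const_mul 4
  have h5 := (hA.mul hx).abs
  have := (((h1.add h2).add h3).add h4).add h5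
  simp only [mul_zero, abs_zero, add_zero, ne_eq, OfNat.ofNat_ne_zero, not_false_eq_true, zero_pow] at this
  exact this

lemma ev_bound (t b : ℝ) :
    (t ^ 2 * zeta3 / (Real.pi ^ 2 / 6) ^ 3 < b → ∀ᶠ n : ℕ in atTop,
      Real.exp (-t * (6 / Real.pi ^ 2) * Real.sqrt (Real.log n)) *
          M n (t / Real.sqrt (Real.log n)) ≤ Real.exp (b + YY t b n)) ∧
    (b < t ^ 2 * zeta3 / (Real.pi ^ 2 / 6) ^ 3 → ∀ᶠ n : ℕ in atTop,
      Real.exp (b - YY t b n) ≤ Real.exp (-t * (6 / Real.pi ^ 2) * Real.sqrt (Real.log n)) *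
          M n (t / Real.sqrt (Real.log n))) := by
  have hx := tend_x
  have hA : Tendsto (fun n : ℕ => t / (Real.pi^2/6) + b * (Real.sqrt (Real.log n))⁻¹) atTop
      (nhds (t / (Real.pi^2/6) + b * 0)) := (hx.const_mul b).const_add _
  have h5 := (hA.mul hx).abs
  have h6 := (hx.const_mul t).abs
  simp only [mul_zero, abs_zero] at h5 h6
  have hE := (EE_tendsto (t / (Real.pi^2/6)) b).comp hx
  have hZ : 0 < Real.pi^2/6 := by positivity
  have key : ∀ᶠ n : ℕ in atTop, 
    (EE (t / (Real.pi^2/6)) b (Real.sqrt (Real.log n))⁻¹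
        < Real.pi^2/6 * (b - t^2 * zeta3 / (Real.pi^2/6)^3) →
      Real.exp (-t * (6 / Real.pi ^ 2) * Real.sqrt (Real.log n)) *
          M n (t / Real.sqrt (Real.log n)) ≤ Real.exp (b + YY t b n)) ∧
    (EE (t / (Real.pi^2/6)) b (Real.sqrt (Real.log n))⁻¹
        < - (Real.pi^2/6 * (b - t^2 * zeta3 / (Real.pi^2/6)^3)) →
      Real.exp (b - YY t b n) ≤ Real.exp (-t * (6 / Real.pi ^ 2) * Real.sqrt (Real.log n)) *
          M n (t / Real.sqrt (Real.log n))) := by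
    filter_upwards [h5.eventually_le_const (show (0:ℝ) < 1/2 by norm_num),
      h6.eventually_le_const (show (0:ℝ) < 1/4 by norm_num), eventually_ge_atTop 2] with n h1 h2 hn
    obtain ⟨m, rfl⟩ : ∃ m, n = m + 1 := ⟨n-1, by omega⟩
    have hlog : 0 < Real.log ((m+1:ℕ):ℝ) :=
      Real.log_pos (by exact_mod_cast (by omega : 1 < m+1))
    have hL : Real.log ((m+1:ℕ):ℝ) = 1 / ((Real.sqrt (Real.log ((m+1:ℕ):ℝ)))⁻¹)^2 := by
      rw [inv_pow, Real.sq_sqrt hlog.le]; simp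
    have hmain := main_bound t b (Real.sqrt (Real.log ((m+1:ℕ):ℝ)))⁻¹ (YY t b (m+1))
      (by have := Real.sqrt_pos.2 hlog; positivity) m hL h2 h1 (by rw [← hL]; rfl)
    have e : -(t / (Real.pi^2/6) / (Real.sqrt (Real.log ((m+1:ℕ):ℝ)))⁻¹)
       = -t * (6 / Real.pi ^ 2) * Real.sqrt (Real.log ((m+1:ℕ):ℝ)) := by
      rw [div_inv_eq_mul]; field_simp
    rw [e, ← div_eq_mul_inv] at hmain
    exact hmain
  constructor
  · intro hb
    have : 0 < Real.pi^2/6 * (b - t^2 * zeta3 / (Real.pi^2/6)^3) := mul_pos hZ (by linarith)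
    filter_upwards [key, hE.eventually_lt_const this] with n h1 h2
    exact h1.1 h2
  · intro hb
    have : 0 < - (Real.pi^2/6 * (b - t^2 * zeta3 / (Real.pi^2/6)^3)) := by
      rw [← mul_neg]; exact mul_pos hZ (by linarith)
    filter_upwards [key, hE.eventually_lt_const this] with n h1 h2
    exact h1.2 h2

/--
For every real `t`,
`lim_{n→∞} exp(-t·(6/π²)·√(log n)) · M_n(t/√(log n)) = exp(t²·ζ(3)/ζ(2)³)`,
which says that `(D_n − μ log n)/√(log n)` converges in distribution to `Normal(0, σ²)` with
`μ = 1/ζ(2) = 6/π²` and `σ² = 2ζ(3)/ζ(2)³`.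
-/
theorem stmt18 (t : ℝ) :
    Tendsto (fun n : ℕ =>
        Real.exp (-t * (6 / Real.pi ^ 2) * Real.sqrt (Real.log n)) *
          M n (t / Real.sqrt (Real.log n)))
      atTop (nhds (Real.exp (t ^ 2 * zeta3 / (Real.pi ^ 2 / 6) ^ 3))) := by
  set c := t ^ 2 * zeta3 / (Real.pi ^ 2 / 6) ^ 3 with hc
  rw [tendsto_order]
  constructor
  · intro a ha
    have h1 : ∃ b < c, a < Real.exp b := by
      have h := Real.continuous_exp.tendsto c
      have h2 := (h.eventually_const_lt ha).filter_mono (nhdsWithin_le_nhds (s := Set.Iio c))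
      obtain ⟨b, hb, hb'⟩ := (h2.and self_mem_nhdsWithin).exists
      exact ⟨b, hb', hb⟩
    obtain ⟨b, hb, hab⟩ := h1
    have hY : Tendsto (fun n => Real.exp (b - YY t b n)) atTop (nhds (Real.exp b)) := by
      have := (YY_tendsto t b).const_sub b
      rw [sub_zero] at this
      exact (Real.continuous_exp.tendsto b).comp this
    filter_upwards [(ev_bound t b).2 hb, hY.eventually_const_lt hab] with n h2 h3
    exact h3.trans_le h2
  · intro a ha
    have h1 : ∃ b > c, Real.exp b < a := by
      have h := Real.continuous_exp.tendsto c
      have h2 := (h.eventually_lt_const ha).filter_mono (nhdsWithin_le_nhds (s := Set.Ioi c))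
      obtain ⟨b, hb, hb'⟩ := (h2.and self_mem_nhdsWithin).exists
      exact ⟨b, hb', hb⟩
    obtain ⟨b, hb, hab⟩ := h1
    have hY : Tendsto (fun n => Real.exp (b + YY t b n)) atTop (nhds (Real.exp b)) := by
      have := (YY_tendsto t b).const_add b
      rw [add_zero] at this
      exact (Real.continuous_exp.tendsto b).comp this
    filter_upwards [(ev_bound t b).1 hb, hY.eventually_lt_const hab] with n h2 h3
    exact h2.trans_lt h3
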